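/- Let R1 and R2 be relations over attribute sets U1 and U2, F a filter over U1 ∪ U2, and K = U1 ∩ U2. If π_{U1}(R1 ⋈ R2) ≡ R1, then σ_{⋀_{u∈K} ¬isNull(u)} R1 ⟕_F R2 ≡ ρ^{U2∖U1}_{{u/if(F, u, null) | u ∈ U2∖U1}}(R1 ⋈ R2), i.e., the filtered left join of the K-non-null part of R1 with R2 equals the natural inner join R1 ⋈ R2 in which, in each tuple, the value of every attribute u ∈ U2 ∖ U1 is replaced by the value of if(F, u, null). -/

import Mathlib

noncomputable section
open Classical

attribute [local instance 10] Classical.propDecidable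

namespace RA

variable {A Δ : Type} [DecidableEq A] [DecidableEq Δ]

/-- Three-valued logic: true, false, unknown (error). -/
inductive TV where
  | tt | ff | unk
deriving DecidableEq

/-- Kleene conjunction. -/
def TV.and : TV → TV → TV
  | .ff, _ => .ff
  | _, .ff => .ff
  | .tt, .tt => .tt
  | _, _ => .unk

/-- Kleene negation. -/
def TV.not : TV → TV
  | .tt => .ff
  | .ff => .tt
  | .unk => .unk

mutual
/-- Terms over attributes `A` and domain `Δ`: attributes, constants and conditionals. -/
inductive Term (A Δ : Type) where
  | attr : A → Term A Δ
  | const : Δ → Term A Δ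
  | ite : Filter A Δ → Term A Δ → Term A Δ → Term A Δ

/-- RA filters: `isNull` on a (finite) set of terms, equality, conjunction, negation. -/
inductive Filter (A Δ : Type) where
  | isNull : List (Term A Δ) → Filter A Δ
  | eq : Term A Δ → Term A Δ → Filter A Δ
  | and : Filter A Δ → Filter A Δ → Filter A Δ
  | not : Filter A Δ → Filter A Δ
end

/-- Disjunction: `F1 ∨ F2 = ¬(¬F1 ∧ ¬F2)`. -/
def Filter.or (F1 F2 : Filter A Δ) : Filter A Δ := .not ((Filter.not F1).and (Filter.not F2))

/-- The tautological filter ⊤ (`isNull` of the empty set of terms is always true). -/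
def Filter.tru : Filter A Δ := .isNull []

/-- A tuple over a set of attributes: `none` marks attributes outside the set. -/
abbrev Tuple (A Δ : Type) := A → Option Δ

mutual
/-- Evaluation of a term on a tuple (`null` is the distinguished null value of `Δ`). -/
def Term.eval (null : Δ) (t : Tuple A Δ) : Term A Δ → Δ
  | .attr a => (t a).getD null
  | .const c => c
  | .ite F v v' => if F.eval null t = TV.tt then v.eval null t else v'.eval null t

def Term.evalList (null : Δ) (t : Tuple A Δ) : List (Term A Δ) → List Δ
  | [] => []
  | v :: vs => v.eval null t :: Term.evalList null t vs

/-- Three-valued evaluation of a filter on a tuple. -/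
def Filter.eval (null : Δ) (t : Tuple A Δ) : Filter A Δ → TV
  | .isNull V => if ∀ d ∈ Term.evalList null t V, d = null then .tt else .ff
  | .eq v v' =>
      if v.eval null t = null ∨ v'.eval null t = null then .unk
      else if v.eval null t = v'.eval null t then .tt else .ff
  | .and F1 F2 => (F1.eval null t).and (F2.eval null t)
  | .not F => (F.eval null t).not
end

mutual
/-- Attributes occurring in a term. -/
def Term.attrs : Term A Δ → Finset A
  | .attr a => {a}
  | .const _ => ∅
  | .ite F v v' => F.attrs ∪ v.attrs ∪ v'.attrs

def Term.attrsList : List (Term A Δ) → Finset A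
  | [] => ∅
  | v :: vs => v.attrs ∪ Term.attrsList vs

/-- Attributes occurring in a filter. -/
def Filter.attrs : Filter A Δ → Finset A
  | .isNull V => Term.attrsList V
  | .eq v v' => v.attrs ∪ v'.attrs
  | .and F1 F2 => F1.attrs ∪ F2.attrs
  | .not F => F.attrs
end

/-- A term is over `U` if all its attributes are in `U`. -/
def Term.over (v : Term A Δ) (U : Finset A) : Prop := v.attrs ⊆ U

/-- A filter is over `U` if all its attributes are in `U`. -/
def Filter.over (F : Filter A Δ) (U : Finset A) : Prop := F.attrs ⊆ U

/-- A tuple is over `U` if its domain is exactly `U`. -/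
def Tuple.isOver (t : Tuple A Δ) (U : Finset A) : Prop := ∀ a, (t a).isSome ↔ a ∈ U

/-- A relation is a bag (multiset) of tuples. -/
abbrev Rel (A Δ : Type) := Multiset (Tuple A Δ)

/-- A relation is over `U` if all its tuples are. -/
def Rel.isOver (R : Rel A Δ) (U : Finset A) : Prop := ∀ t ∈ R, t.isOver U

/-- Selection σ_F. -/
def select (null : Δ) (F : Filter A Δ) (R : Rel A Δ) : Rel A Δ :=
  R.filter (fun t => F.eval null t = .tt)

/-- Restriction of a tuple to the attributes in `U`. -/
def Tuple.restrict (t : Tuple A Δ) (U : Finset A) : Tuple A Δ :=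
  fun a => if a ∈ U then t a else none

/-- Projection π_U (bag semantics: multiplicities are added up). -/
def proj (U : Finset A) (R : Rel A Δ) : Rel A Δ := R.map (·.restrict U)

/-- Bag difference: `(R1 ∖ R2)(t) = R1(t)` if `t ∉ R2` and `0` otherwise. -/
def bdiff (R1 R2 : Rel A Δ) : Rel A Δ := R1.filter (fun t => t ∉ R2)

/-- Compatibility of tuples: equal and non-null on the shared attributes. -/
def Compat (null : Δ) (t1 t2 : Tuple A Δ) : Prop :=
  ∀ a, (t1 a).isSome → (t2 a).isSome → (t1 a = t2 a ∧ t1 a ≠ some null)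

/-- `t1 ⊕ t2`: the common extension of two (compatible) tuples. -/
def Tuple.merge (t1 t2 : Tuple A Δ) : Tuple A Δ :=
  fun a => (t1 a).or (t2 a)

/-- Natural join. -/
def join (null : Δ) (R1 R2 : Rel A Δ) : Rel A Δ :=
  (R1.product R2).filterMap
    (fun p => if Compat null p.1 p.2 then some (p.1.merge p.2) else none)

/-- Natural join with a filter: `R1 ⋈_F R2 = σ_F (R1 ⋈ R2)`. -/
def joinF (null : Δ) (F : Filter A Δ) (R1 R2 : Rel A Δ) : Rel A Δ :=
  select null F (join null R1 R2)

/-- Padding of a tuple with `null` on the attributes of `V`. -/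
def Tuple.pad (null : Δ) (V : Finset A) (t : Tuple A Δ) : Tuple A Δ :=
  fun a => if a ∈ V then (t a).or (some null) else t a

/-- Outer union of `R1` over `U1` and `R2` over `U2`:
each relation is padded with nulls on the attributes missing from it. -/
def ounion (null : Δ) (U1 U2 : Finset A) (R1 R2 : Rel A Δ) : Rel A Δ :=
  R1.map (Tuple.pad null (U2 \ U1)) + R2.map (Tuple.pad null (U1 \ U2))

/-- Left join `R1 ⟕_F R2 = (R1 ⋈_F R2) ⊎ (R1 ∖ π_{U1}(R1 ⋈_F R2))`
for `R1` over `U1` and `R2` over `U2`. -/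
def ljoin (null : Δ) (U1 U2 : Finset A) (F : Filter A Δ) (R1 R2 : Rel A Δ) : Rel A Δ :=
  ounion null (U1 ∪ U2) U1 (joinF null F R1 R2) (bdiff R1 (proj U1 (joinF null F R1 R2)))

/-- Natural left join `R1 ⟕ R2 = R1 ⟕_⊤ R2`. -/
def nljoin (null : Δ) (U1 U2 : Finset A) (R1 R2 : Rel A Δ) : Rel A Δ :=
  ljoin null U1 U2 Filter.tru R1 R2

/-- Extension ν_{u↦v}. -/
def extend (null : Δ) (u : A) (v : Term A Δ) (R : Rel A Δ) : Rel A Δ :=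
  R.map (fun t a => if a = u then some (v.eval null t) else t a)

/-- Duplicate elimination δ. -/
def dedup (R : Rel A Δ) : Rel A Δ := R.dedup

/-- Extended renaming ρ^V_{{u/f(u) | u ∈ S}} at the level of tuples:
each attribute `u ∈ S` receives the value of the term `f u` (evaluated on the original
tuple) and the attributes of `V ∖ S` are projected away. -/
def renameFun (null : Δ) (V S : Finset A) (f : A → Term A Δ) (t : Tuple A Δ) : Tuple A Δ :=
  fun a => if a ∈ S then some ((f a).eval null t) else if a ∈ V then none else t a

/-- Extended renaming ρ^V_{{u/f(u) | u ∈ S}}. -/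
def rename (null : Δ) (V S : Finset A) (f : A → Term A Δ) (R : Rel A Δ) : Rel A Δ :=
  R.map (renameFun null V S f)

/-- Renaming of the attribute `uold` into `unew` at the level of tuples. -/
def renameAttrT (unew uold : A) (t : Tuple A Δ) : Tuple A Δ :=
  fun a => if a = unew then t uold else if a = uold then none else t a

/-- `R[unew/uold]`: the relation `R` with the attribute `uold` renamed to `unew`. -/
def renameAttr (unew uold : A) (R : Rel A Δ) : Rel A Δ := R.map (renameAttrT unew uold)

/-- `coalesce(v, v') = if(¬isNull(v), v, v')`. -/
def Term.coalesce (v v' : Term A Δ) : Term A Δ := .ite (.not (.isNull [v])) v v'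

/-- The filter `⋀_{u ∈ K} ¬isNull(u)`. -/
def notNullAll (K : Finset A) : Filter A Δ :=
  K.toList.foldr (fun u acc => (Filter.not (.isNull [.attr u])).and acc) Filter.tru

mutual
/-- `nullify_S`: replace every occurrence of an attribute from `S` by the constant null. -/
def Term.nullify (null : Δ) (S : Finset A) : Term A Δ → Term A Δ
  | .attr a => if a ∈ S then .const null else .attr a
  | .const c => .const c
  | .ite F v v' => .ite (F.nullify null S) (v.nullify null S) (v'.nullify null S)

def Term.nullifyList (null : Δ) (S : Finset A) : List (Term A Δ) → List (Term A Δ)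
  | [] => []
  | v :: vs => v.nullify null S :: Term.nullifyList null S vs

/-- `nullify_S` on filters. -/
def Filter.nullify (null : Δ) (S : Finset A) : Filter A Δ → Filter A Δ
  | .isNull V => .isNull (Term.nullifyList null S V)
  | .eq v v' => .eq (v.nullify null S) (v'.nullify null S)
  | .and F1 F2 => .and (F1.nullify null S) (F2.nullify null S)
  | .not F => .not (F.nullify null S)
end

/-- p-equivalence of filters over `U`: they are ⊤ on the same tuples over `U`. -/
def pequiv (null : Δ) (U : Finset A) (F1 F2 : Filter A Δ) : Prop :=
  ∀ t : Tuple A Δ, t.isOver U → (F1.eval null t = TV.tt ↔ F2.eval null t = TV.tt)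

end RA

namespace RA

variable {A Δ : Type} [DecidableEq A] [DecidableEq Δ]

omit [DecidableEq A] [DecidableEq Δ] in
theorem join_eq_bind (null : Δ) (R1 R2 : Rel A Δ) :
    join null R1 R2 = R1.bind fun t => (R2.filter (Compat null t)).map t.merge := by
  unfold join
  induction R1 using Multiset.induction_on with
  | empty => rfl
  | cons t R ih =>
    have hprod : Multiset.product (t ::ₘ R) R2 = R2.map (Prod.mk t) + Multiset.product R R2 :=
      Multiset.cons_product t R R2
    rw [hprod, Multiset.cons_bind, Multiset.filterMap_add, ih, Multiset.filterMap_map,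
      ← Multiset.filterMap_eq_map, ← Multiset.filterMap_eq_filter, Multiset.filterMap_filterMap]
    congr 1
    refine congrArg (Multiset.filterMap · R2) (funext fun s => ?_)
    by_cases h : Compat null t s <;> simp [h, Option.guard]

omit [DecidableEq Δ] in
theorem restrict_merge {U : Finset A} {t : Tuple A Δ} (ht : t.isOver U) {s : Tuple A Δ} :
    (t.merge s).restrict U = t := by
  funext a
  have := ht a
  unfold Tuple.restrict Tuple.merge
  by_cases h : a ∈ U <;> cases h' : t a <;> simp_all

theorem count_bind_replicate {α : Type*} [DecidableEq α] (R : Multiset α) (k : α → ℕ) (a : α) :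
    (R.bind fun t => Multiset.replicate (k t) t).count a = R.count a * k a := by
  induction R using Multiset.induction_on with
  | empty => simp
  | cons t R ih =>
    rw [Multiset.cons_bind, Multiset.count_add, ih, Multiset.count_replicate, Multiset.count_cons]
    by_cases h : t = a
    · subst h; simp; ring
    · simp [h, Ne.symm h]

omit [DecidableEq Δ] in
/-- If projecting the join gives back the left relation, each of its tuples has exactly one
compatible partner. -/
theorem exists_unique_partner {null : Δ} {U1 : Finset A} {R1 R2 : Rel A Δ} (hR1 : R1.isOver U1)
    (h : proj U1 (join null R1 R2) = R1) :
    ∃ g : Tuple A Δ → Tuple A Δ, ∀ t ∈ R1, R2.filter (Compat null t) = {g t} := by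
  have hproj : proj U1 (join null R1 R2)
      = R1.bind fun t => Multiset.replicate (R2.filter (Compat null t)).card t := by
    rw [join_eq_bind, proj, Multiset.map_bind]
    refine Multiset.bind_congr fun t ht => ?_
    rw [Multiset.map_map, ← Multiset.map_const']
    exact Multiset.map_congr rfl fun s _ => restrict_merge (hR1 t ht)
  have hex : ∀ t, ∃ s, t ∈ R1 → R2.filter (Compat null t) = {s} := by
    intro t
    by_cases ht : t ∈ R1
    · have hc := congrArg (Multiset.count t) (hproj.symm.trans h)
      rw [count_bind_replicate] at hc
      have hpos := Multiset.count_pos.2 ht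
      obtain ⟨s, hs⟩ := Multiset.card_eq_one.1 (Nat.eq_of_mul_eq_mul_left hpos
        (hc.trans (mul_one _).symm))
      exact ⟨s, fun _ => hs⟩
    · exact ⟨t, fun h' => absurd h' ht⟩
  choose g hg using hex
  exact ⟨g, hg⟩

omit [DecidableEq A] in
theorem notNullAll_eval_eq_tt {null : Δ} {K : Finset A} {t : Tuple A Δ}
    (h : ∀ a ∈ K, (t a).getD null ≠ null) : (notNullAll K).eval null t = .tt := by
  unfold notNullAll
  replace h : ∀ a ∈ K.toList, (t a).getD null ≠ null := fun a ha => h a (Finset.mem_toList.1 ha)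
  generalize K.toList = l at h
  induction l with
  | nil => simp [Filter.tru, Filter.eval, Term.evalList]
  | cons a l ih =>
    have ha := h a (by simp)
    simp only [List.foldr_cons, Filter.eval,
      ih fun b hb => h b (List.mem_cons_of_mem a hb)]
    simp [Term.evalList, Term.eval, ha, TV.not, TV.and]

theorem renameFun_of_tt {null : Δ} {V : Finset A} {F : Filter A Δ} {t : Tuple A Δ}
    (hF : F.eval null t = .tt) (hV : ∀ a ∈ V, (t a).isSome) :
    renameFun null V V (fun u => .ite F (.attr u) (.const null)) t = t := by
  funext a
  by_cases ha : a ∈ V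
  · obtain ⟨d, hd⟩ := Option.isSome_iff_exists.1 (hV a ha)
    simp [renameFun, ha, Term.eval, hF, hd]
  · simp [renameFun, ha]

theorem renameFun_merge_of_not_tt {null : Δ} {U1 U2 : Finset A} {F : Filter A Δ}
    {t s : Tuple A Δ} (ht : t.isOver U1) (hs : s.isOver U2) (hF : F.eval null (t.merge s) ≠ .tt) :
    renameFun null (U2 \ U1) (U2 \ U1) (fun u => .ite F (.attr u) (.const null)) (t.merge s)
      = t.pad null ((U1 ∪ U2) \ U1) := by
  funext a
  have h1 := ht a
  have h2 := hs a
  by_cases ha : a ∈ U1 <;> by_cases hb : a ∈ U2 <;> cases hta : t a <;> cases hsa : s a <;>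
    simp_all [renameFun, Tuple.pad, Term.eval, Tuple.merge]

theorem stmt14 (null : Δ) (U1 U2 : Finset A) (R1 R2 : Rel A Δ) (F : Filter A Δ)
    (hR1 : R1.isOver U1) (hR2 : R2.isOver U2) (hF : F.over (U1 ∪ U2))
    (hmain : proj U1 (join null R1 R2) = R1) :
    ljoin null U1 U2 F (select null (notNullAll (U1 ∩ U2)) R1) R2
      = rename null (U2 \ U1) (U2 \ U1) (fun u => .ite F (.attr u) (.const null))
          (join null R1 R2) := by
  obtain ⟨g, hg⟩ := exists_unique_partner hR1 hmain
  have hpartner : ∀ t ∈ R1, g t ∈ R2 ∧ Compat null t (g t) := fun t ht =>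
    Multiset.mem_filter.1 (hg t ht ▸ Multiset.mem_singleton_self (g t))
  have hjoin : join null R1 R2 = R1.map fun t => t.merge (g t) := by
    rw [join_eq_bind, ← Multiset.bind_singleton]
    exact Multiset.bind_congr fun t ht => by rw [hg t ht, Multiset.map_singleton]
  have hsel : select null (notNullAll (U1 ∩ U2)) R1 = R1 := by
    refine Multiset.filter_eq_self.2 fun t ht => notNullAll_eval_eq_tt fun a ha => ?_
    obtain ⟨ha1, ha2⟩ := Finset.mem_inter.1 ha
    have hsome := (hR1 t ht a).2 ha1
    have hne := ((hpartner t ht).2 a hsome ((hR2 _ (hpartner t ht).1 a).2 ha2)).2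
    obtain ⟨d, hd⟩ := Option.isSome_iff_exists.1 hsome
    simpa [hd] using hne
  have hjoinF : joinF null F R1 R2
      = (R1.filter fun t => F.eval null (t.merge (g t)) = .tt).map fun t => t.merge (g t) := by
    rw [joinF, select, hjoin, Multiset.filter_map]
    rfl
  have hdiff : bdiff R1 (proj U1 (joinF null F R1 R2))
      = R1.filter fun t => ¬ F.eval null (t.merge (g t)) = .tt := by
    refine Multiset.filter_congr fun t ht => not_congr ?_
    simp only [hjoinF, proj, Multiset.map_map, Function.comp_apply, Multiset.mem_map,
      Multiset.mem_filter]
    constructor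
    · rintro ⟨s, ⟨hs, hsF⟩, hst⟩
      rw [restrict_merge (hR1 s hs)] at hst
      exact hst ▸ hsF
    · exact fun h => ⟨t, ⟨ht, h⟩, restrict_merge (hR1 t ht)⟩
  rw [hsel, ljoin, ounion, hdiff, hjoinF, rename, hjoin, Multiset.map_map, Multiset.map_map]
  conv_rhs => rw [← Multiset.filter_add_not (fun t => F.eval null (t.merge (g t)) = .tt) R1,
    Multiset.map_add]
  congr 1
  · refine Multiset.map_congr rfl fun t ht => ?_
    obtain ⟨ht1, htF⟩ := Multiset.mem_filter.1 ht
    have hV : ∀ a ∈ U2 \ U1, ((t.merge (g t)) a).isSome := fun a ha => by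
      have := (hR2 _ (hpartner t ht1).1 a).2 (Finset.mem_sdiff.1 ha).1
      simp [Tuple.merge, this]
    rw [Function.comp_apply, Function.comp_apply, renameFun_of_tt htF hV]
    funext a
    simp +contextual [Tuple.pad]
  · refine Multiset.map_congr rfl fun t ht => ?_
    obtain ⟨ht1, htF⟩ := Multiset.mem_filter.1 ht
    exact (renameFun_merge_of_not_tt (hR1 t ht1) (hR2 _ (hpartner t ht1).1) htF).symm

end RA
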